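/- Let ψ := ∃x P(x,x) ∧ (∃^{≤1}x Q(x,x) ∨ ∃^{≥2}x P(x,x)) over a signature with two binary relation symbols P,Q. Then: (i) ψ is preserved under disjoint unions, i.e., for every family (𝔄_i)_{i∈I} of structures, if 𝔄_i ⊨ ψ for all i∈I then the disjoint union ⊎_{i∈I}𝔄_i ⊨ ψ; (ii) letting 𝔄 be the structure with domain {a,b}, with P(a,a) and Q(b,b) the only relation tuples, and 𝔅 the structure with domain {c,d,e}, with P(c,c), Q(d,d), Q(e,e) the only relation tuples, we have 𝔄 ⊨ ψ and 𝔅 ⊭ ψ, yet every sentence of the form ∀x α(x), with α(x) constructed from atomic formulas and their negations using ∧, ∨, ∃, and restricted universal quantifiers of the forms ∀y(R(z,y)→…) and ∀y(R(y,z)→…) (z a variable distinct from y, R ∈ {P,Q}), that is true in 𝔄 is also true in 𝔅. Consequently ψ is not equivalent (even over finite structures) to any sentence of that form. -/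

import Mathlib

/-- A frame: a first-order structure over a signature consisting of
binary relation symbols indexed by `I`. -/
structure KFrame (I : Type) where
  W : Type
  R : I → W → W → Prop

/-- First-order formulas over a signature of binary relation symbols indexed
by `I`, with variables indexed by `ℕ`. -/
inductive FO (I : Type) : Type
  | eq : ℕ → ℕ → FO I
  | rel : I → ℕ → ℕ → FO I
  | fal : FO I
  | neg : FO I → FO I
  | and : FO I → FO I → FO I
  | or : FO I → FO I → FO I
  | imp : FO I → FO I → FO I
  | ex : ℕ → FO I → FO I
  | all : ℕ → FO I → FO I

/-- Tarskian satisfaction of a first-order formula in a frame, relative to a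
variable assignment `g`. -/
def FOSat {I : Type} (F : KFrame I) : (ℕ → F.W) → FO I → Prop
  | g, .eq x y => g x = g y
  | g, .rel i x y => F.R i (g x) (g y)
  | _, .fal => False
  | g, .neg φ => ¬ FOSat F g φ
  | g, .and φ ψ => FOSat F g φ ∧ FOSat F g ψ
  | g, .or φ ψ => FOSat F g φ ∨ FOSat F g ψ
  | g, .imp φ ψ => FOSat F g φ → FOSat F g ψ
  | g, .ex x φ => ∃ d : F.W, FOSat F (Function.update g x d) φ
  | g, .all x φ => ∀ d : F.W, FOSat F (Function.update g x d) φ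

/-- The free variables of a first-order formula. -/
def freeVars {I : Type} : FO I → Finset ℕ
  | .eq x y => {x, y}
  | .rel _ x y => {x, y}
  | .fal => ∅
  | .neg φ => freeVars φ
  | .and φ ψ => freeVars φ ∪ freeVars ψ
  | .or φ ψ => freeVars φ ∪ freeVars ψ
  | .imp φ ψ => freeVars φ ∪ freeVars ψ
  | .ex x φ => freeVars φ \ {x}
  | .all x φ => freeVars φ \ {x}

/-- Truth of a (closed) first-order formula in a frame. -/
def FrameSat {I : Type} (F : KFrame I) (φ : FO I) : Prop :=
  ∀ g : ℕ → F.W, FOSat F g φ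

/-- The disjoint union of a family of frames. -/
def disjUnion {I ι : Type} (F : ι → KFrame I) : KFrame I where
  W := Σ i : ι, (F i).W
  R := fun r x y =>
    ∃ (i : ι) (u v : (F i).W), x = ⟨i, u⟩ ∧ y = ⟨i, v⟩ ∧ (F i).R r u v

/- Relation indices in `Fin 2`: `P = 0`, `Q = 1`. -/

/-- `ψ := ∃x P(x,x) ∧ (∃^{≤1}x Q(x,x) ∨ ∃^{≥2}x P(x,x))`. -/
def psiSentence : FO (Fin 2) :=
  .and (.ex 0 (.rel 0 0 0))
    (.or
      (.all 0 (.all 1 (.imp (.and (.rel 1 0 0) (.rel 1 1 1)) (.eq 0 1))))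
      (.ex 0 (.ex 1 (.and (.neg (.eq 0 1)) (.and (.rel 0 0 0) (.rel 0 1 1))))))

/-- The structure `𝔄` with domain `{a, b}` (`a = false`, `b = true`),
with `P(a,a)` and `Q(b,b)` the only relational tuples. -/
def frameA : KFrame (Fin 2) where
  W := Bool
  R := fun i x y =>
    if i = 0 then x = false ∧ y = false else x = true ∧ y = true

/-- The structure `𝔅` with domain `{c, d, e}` (`c = 0`, `d = 1`, `e = 2`),
with `P(c,c)`, `Q(d,d)`, `Q(e,e)` the only relational tuples. -/
def frameB : KFrame (Fin 2) where
  W := Fin 3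
  R := fun i x y =>
    if i = 0 then x = 0 ∧ y = 0 else (x = 1 ∧ y = 1) ∨ (x = 2 ∧ y = 2)

/-- Formulas constructed from atomic formulas and their negations using `∧`,
`∨`, `∃`, and restricted universal quantifiers of the forms `∀y(R(z,y) → …)`
and `∀y(R(y,z) → …)` with `z` a variable distinct from `y`. -/
inductive RestrUniv {I : Type} : FO I → Prop
  | eq (x y : ℕ) : RestrUniv (.eq x y)
  | neq (x y : ℕ) : RestrUniv (.neg (.eq x y))
  | rel (i : I) (x y : ℕ) : RestrUniv (.rel i x y)
  | nrel (i : I) (x y : ℕ) : RestrUniv (.neg (.rel i x y))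
  | and {φ ψ : FO I} : RestrUniv φ → RestrUniv ψ → RestrUniv (.and φ ψ)
  | or {φ ψ : FO I} : RestrUniv φ → RestrUniv ψ → RestrUniv (.or φ ψ)
  | ex (x : ℕ) {φ : FO I} : RestrUniv φ → RestrUniv (.ex x φ)
  | allL (i : I) (z y : ℕ) {φ : FO I} :
      y ≠ z → RestrUniv φ → RestrUniv (.all y (.imp (.rel i z y) φ))
  | allR (i : I) (z y : ℕ) {φ : FO I} :
      y ≠ z → RestrUniv φ → RestrUniv (.all y (.imp (.rel i y z) φ))

/-- Satisfaction depends only on the values of the free variables. -/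
theorem FOSat_congr {I : Type} (F : KFrame I) (φ : FO I) :
    ∀ {g h : ℕ → F.W}, (∀ n ∈ freeVars φ, g n = h n) → (FOSat F g φ ↔ FOSat F h φ) := by
  have update_agree : ∀ {s : Finset ℕ} {x : ℕ} {g h : ℕ → F.W} (d : F.W),
      (∀ n ∈ s \ {x}, g n = h n) →
        ∀ n ∈ s, Function.update g x d n = Function.update h x d n := by
    intro s x g h d H n hn
    by_cases hx : n = x
    · subst hx; simp
    · simpa [hx] using H n (by simp [hn, hx])
  induction φ with
  | eq x y =>
    intro g h H
    simp [FOSat, H x (by simp [freeVars]), H y (by simp [freeVars])]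
  | rel i x y =>
    intro g h H
    simp [FOSat, H x (by simp [freeVars]), H y (by simp [freeVars])]
  | fal => intro g h _; rfl
  | neg φ ih => intro g h H; exact not_congr (ih H)
  | and φ ψ ih₁ ih₂ =>
    intro g h H
    exact and_congr (ih₁ fun n hn => H n (by simp [freeVars, hn]))
      (ih₂ fun n hn => H n (by simp [freeVars, hn]))
  | or φ ψ ih₁ ih₂ =>
    intro g h H
    exact or_congr (ih₁ fun n hn => H n (by simp [freeVars, hn]))
      (ih₂ fun n hn => H n (by simp [freeVars, hn]))
  | imp φ ψ ih₁ ih₂ =>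
    intro g h H
    exact imp_congr (ih₁ fun n hn => H n (by simp [freeVars, hn]))
      (ih₂ fun n hn => H n (by simp [freeVars, hn]))
  | ex x φ ih => intro g h H; exact exists_congr fun d => ih (update_agree d H)
  | all x φ ih => intro g h H; exact forall_congr' fun d => ih (update_agree d H)

/-- Restricted formulas are preserved by embeddings whose range is closed under
successors and predecessors of every relation. -/
theorem RestrUniv.sat_comp {I : Type} {F G : KFrame I} {f : F.W → G.W}
    (hf : Function.Injective f) (hR : ∀ i u v, G.R i (f u) (f v) ↔ F.R i u v)
    (hsucc : ∀ i u w, G.R i (f u) w → w ∈ Set.range f)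
    (hpred : ∀ i u w, G.R i w (f u) → w ∈ Set.range f)
    {φ : FO I} (hφ : RestrUniv φ) :
    ∀ g : ℕ → F.W, FOSat F g φ → FOSat G (f ∘ g) φ := by
  induction hφ with
  | eq x y => intro g h; exact congrArg f h
  | neq x y => intro g h e; exact h (hf e)
  | rel i x y => intro g h; exact (hR i _ _).2 h
  | nrel i x y => intro g h e; exact h ((hR i _ _).1 e)
  | and _ _ ih₁ ih₂ => intro g h; exact ⟨ih₁ g h.1, ih₂ g h.2⟩
  | or _ _ ih₁ ih₂ => intro g h; exact h.imp (ih₁ g) (ih₂ g)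
  | ex x _ ih =>
    rintro g ⟨d, hd⟩
    refine ⟨f d, ?_⟩
    rw [← Function.comp_update]
    exact ih _ hd
  | allL i z y hne _ ih =>
    intro g h w hw
    obtain ⟨d, rfl⟩ : w ∈ Set.range f :=
      hsucc i (g z) w (by simpa [FOSat, hne.symm] using hw)
    rw [← Function.comp_update] at hw ⊢
    exact ih _ (h d ((hR i _ _).1 hw))
  | allR i z y hne _ ih =>
    intro g h w hw
    obtain ⟨d, rfl⟩ : w ∈ Set.range f :=
      hpred i (g z) w (by simpa [FOSat, hne.symm] using hw)
    rw [← Function.comp_update] at hw ⊢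
    exact ih _ (h d ((hR i _ _).1 hw))

theorem FOSat_psiSentence_iff (F : KFrame (Fin 2)) (g : ℕ → F.W) :
    FOSat F g psiSentence ↔
      (∃ u, F.R 0 u u) ∧ ((∀ u v, F.R 1 u u → F.R 1 v v → u = v) ∨
        ∃ u v, u ≠ v ∧ F.R 0 u u ∧ F.R 0 v v) := by
  simp [psiSentence, FOSat]

theorem disjUnion_R_iff {I ι : Type} {F : ι → KFrame I} {r : I} {i : ι} {u v : (F i).W} :
    (disjUnion F).R r ⟨i, u⟩ ⟨i, v⟩ ↔ (F i).R r u v := by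
  constructor
  · rintro ⟨j, u', v', hu, hv, h⟩
    cases hu
    cases hv
    exact h
  · exact fun h => ⟨i, u, v, rfl, rfl, h⟩

theorem frameSat_disjUnion_psiSentence {ι : Type} (F : ι → KFrame (Fin 2))
    (hF : ∀ i, FrameSat (F i) psiSentence) : FrameSat (disjUnion F) psiSentence := by
  intro g
  have hψ : ∀ i, (F i).W → _ :=
    fun i w => (FOSat_psiSentence_iff (F i) fun _ => w).1 (hF i fun _ => w)
  rw [FOSat_psiSentence_iff]
  obtain ⟨i, w⟩ := g 0
  obtain ⟨⟨u, hu⟩, hi⟩ := hψ i w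
  refine ⟨⟨⟨i, u⟩, disjUnion_R_iff.2 hu⟩, ?_⟩
  by_cases hne : ∃ j, j ≠ i ∧ Nonempty (F j).W
  · obtain ⟨j, hj, ⟨w'⟩⟩ := hne
    obtain ⟨⟨v, hv⟩, -⟩ := hψ j w'
    exact Or.inr ⟨⟨i, u⟩, ⟨j, v⟩, fun e => hj (congrArg Sigma.fst e).symm,
      disjUnion_R_iff.2 hu, disjUnion_R_iff.2 hv⟩
  · have only : ∀ j, (F j).W → j = i := fun j w' =>
      by_contra fun hj => hne ⟨j, hj, ⟨w'⟩⟩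
    rcases hi with hQ | ⟨a, b, hab, ha, hb⟩
    · left
      rintro ⟨j, a⟩ ⟨k, b⟩ ha hb
      obtain rfl := only j a
      obtain rfl := only k b
      rw [hQ a b (disjUnion_R_iff.1 ha) (disjUnion_R_iff.1 hb)]
    · exact Or.inr ⟨⟨i, a⟩, ⟨i, b⟩, fun e => hab (by cases e; rfl),
        disjUnion_R_iff.2 ha, disjUnion_R_iff.2 hb⟩

theorem frameSat_frameA_psiSentence : FrameSat frameA psiSentence := by
  intro g
  rw [FOSat_psiSentence_iff]
  exact ⟨⟨false, by simp [frameA]⟩, Or.inl fun u v hu hv => by simp_all [frameA]⟩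

theorem not_frameSat_frameB_psiSentence : ¬ FrameSat frameB psiSentence := by
  intro h
  rcases ((FOSat_psiSentence_iff _ _).1 (h fun _ => (0 : Fin 3))).2 with hQ | ⟨u, v, huv, hu, hv⟩
  · exact absurd (hQ (1 : Fin 3) (2 : Fin 3) (by simp [frameB]) (by simp [frameB]))
      (show (1 : Fin 3) ≠ 2 by decide)
  · simp only [frameB, if_true] at hu hv
    exact huv (hu.1.trans hv.1.symm)

theorem eq_of_frameB_R {i : Fin 2} {u v : frameB.W} (h : frameB.R i u v) : u = v := by
  simp only [frameB] at h
  split_ifs at h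
  · exact h.1.trans h.2.symm
  · exact h.elim (fun h => h.1.trans h.2.symm) fun h => h.1.trans h.2.symm

/-- The embedding of `frameA` into `frameB` sending the `Q`-loop to `q`. -/
def embedAB (q : Fin 3) : frameA.W → frameB.W :=
  fun b : Bool => if b then q else (0 : Fin 3)

theorem RestrUniv.sat_embedAB {q : Fin 3} (hq : q ≠ 0) {φ : FO (Fin 2)} (hφ : RestrUniv φ)
    (g : ℕ → frameA.W) (h : FOSat frameA g φ) : FOSat frameB (embedAB q ∘ g) φ := by
  refine RestrUniv.sat_comp ?_ ?_ ?_ ?_ hφ g h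
  · change Function.Injective fun b : Bool => if b then q else (0 : Fin 3)
    revert q; decide
  · change ∀ (i : Fin 2) (u v : Bool),
      (if i = 0 then (if u then q else (0 : Fin 3)) = 0 ∧ (if v then q else (0 : Fin 3)) = 0
        else ((if u then q else (0 : Fin 3)) = 1 ∧ (if v then q else (0 : Fin 3)) = 1) ∨
          ((if u then q else (0 : Fin 3)) = 2 ∧ (if v then q else (0 : Fin 3)) = 2)) ↔
      (if i = 0 then u = false ∧ v = false else u = true ∧ v = true)
    revert q; decide
  · exact fun i u w hw => ⟨u, eq_of_frameB_R hw⟩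
  · exact fun i u w hw => ⟨u, (eq_of_frameB_R hw).symm⟩

theorem exists_embedAB_eq (d : frameB.W) : ∃ q : Fin 3, q ≠ 0 ∧ ∃ e, embedAB q e = d := by
  change Fin 3 at d
  by_cases hd : d = 0
  · exact ⟨1, by decide, false, hd.symm⟩
  · exact ⟨d, hd, true, rfl⟩

theorem RestrUniv.frameSat_frameB {x : ℕ} {α : FO (Fin 2)} (hα : RestrUniv α)
    (hx : freeVars (FO.all x α) = ∅) (hA : FrameSat frameA (.all x α)) :
    FrameSat frameB (.all x α) := by
  intro h d
  obtain ⟨q, hq, e, rfl⟩ := exists_embedAB_eq d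
  refine (FOSat_congr frameB α ?_).1
    (hα.sat_embedAB hq (Function.update (fun _ => e) x e) (hA (fun _ => e) e))
  intro n hn
  have hnx : n = x := by
    simpa using Finset.sdiff_eq_empty_iff_subset.1 hx hn
  simp [hnx]

/-- Counterexample to van Benthem's conjecture on preservation under disjoint
unions: (i) `ψ` is preserved under disjoint unions; (ii) `𝔄 ⊨ ψ`, `𝔅 ⊭ ψ`, yet
every sentence `∀x α(x)` with `α` built using only restricted universal
quantifiers that is true in `𝔄` is true in `𝔅`; consequently `ψ` is not
equivalent, even over finite structures, to any sentence of that form. -/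
theorem psi_disjoint_union_counterexample :
    (∀ (ι : Type) (F : ι → KFrame (Fin 2)),
        (∀ i, FrameSat (F i) psiSentence) → FrameSat (disjUnion F) psiSentence) ∧
    FrameSat frameA psiSentence ∧
    ¬ FrameSat frameB psiSentence ∧
    (∀ (x : ℕ) (α : FO (Fin 2)), RestrUniv α → freeVars (FO.all x α) = ∅ →
        FrameSat frameA (.all x α) → FrameSat frameB (.all x α)) ∧
    ¬ ∃ (x : ℕ) (α : FO (Fin 2)), RestrUniv α ∧ freeVars (FO.all x α) = ∅ ∧
        ∀ F : KFrame (Fin 2), Finite F.W →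
          (FrameSat F psiSentence ↔ FrameSat F (.all x α)) := by
  refine ⟨fun ι F => frameSat_disjUnion_psiSentence F, frameSat_frameA_psiSentence,
    not_frameSat_frameB_psiSentence, fun x α hα hx hA => hα.frameSat_frameB hx hA, ?_⟩
  rintro ⟨x, α, hα, hx, hiff⟩
  have hA : FrameSat frameA (.all x α) :=
    (hiff frameA (inferInstanceAs (Finite Bool))).1 frameSat_frameA_psiSentence
  exact not_frameSat_frameB_psiSentence
    ((hiff frameB (inferInstanceAs (Finite (Fin 3)))).2 (hα.frameSat_frameB hx hA))
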